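/- Let G and H be connected graphs, let M be a nonempty proper module of G, and let G' be the graph obtained from G by replacing G[M] with H. If the maximum induced matchings of G[M] and of H have the same number of edges, then the maximum number of edges of an induced matching of G is at most the maximum number of edges of an induced matching of G'. -/

import Mathlib

open SimpleGraph Set

/-- `M` is a module of `G`: every vertex outside `M` is adjacent to all of `M`
or to none of `M`. -/
def SimpleGraph.IsModuleSet {V : Type*} (G : SimpleGraph V) (M : Set V) : Prop :=
  ∀ v ∉ M, (∀ m ∈ M, G.Adj v m) ∨ (∀ m ∈ M, ¬ G.Adj v m)

/-- The graph obtained from `G` by replacing `G[M]` with `H`: its vertices are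
`(V ∖ M) ⊕ V(H)`, with the edges of `G` outside `M`, the edges of `H`, and all
edges between `N_G(M) ∖ M` and `V(H)`. -/
def modularReplacement {V W : Type*} (G : SimpleGraph V) (M : Set V)
    (H : SimpleGraph W) : SimpleGraph ({v : V // v ∉ M} ⊕ W) :=
  SimpleGraph.fromRel (fun x y =>
    match x, y with
    | Sum.inl u, Sum.inl v => G.Adj u.1 v.1
    | Sum.inl u, Sum.inr _ => ∃ m ∈ M, G.Adj u.1 m
    | Sum.inr _, Sum.inl _ => False
    | Sum.inr u, Sum.inr v => H.Adj u v)

section Invariants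

variable {V : Type*} (G : SimpleGraph V)

/-- A dominating set. -/
def IsDomSet (D : Set V) : Prop := ∀ v ∉ D, ∃ u ∈ D, G.Adj v u

/-- A minimum dominating set. -/
def IsMinDomSet (D : Set V) : Prop :=
  IsDomSet G D ∧ ∀ D', IsDomSet G D' → D.ncard ≤ D'.ncard

/-- The domination number. -/
noncomputable def domNum : ℕ := sInf {n | ∃ D, IsDomSet G D ∧ D.ncard = n}

/-- A vertex cover. -/
def IsVCover (C : Set V) : Prop := ∀ ⦃u v⦄, G.Adj u v → u ∈ C ∨ v ∈ C

/-- A minimum vertex cover. -/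
def IsMinVCover (C : Set V) : Prop :=
  IsVCover G C ∧ ∀ C', IsVCover G C' → C.ncard ≤ C'.ncard

/-- The vertex cover number. -/
noncomputable def vcNum : ℕ := sInf {n | ∃ C, IsVCover G C ∧ C.ncard = n}

/-- A connected vertex cover. -/
def IsCVCover (C : Set V) : Prop := IsVCover G C ∧ (G.induce C).Connected

/-- A minimum connected vertex cover. -/
def IsMinCVCover (C : Set V) : Prop :=
  IsCVCover G C ∧ ∀ C', IsCVCover G C' → C.ncard ≤ C'.ncard

/-- The connected vertex cover number. -/
noncomputable def cvcNum : ℕ := sInf {n | ∃ C, IsCVCover G C ∧ C.ncard = n}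

/-- A feedback vertex set: its removal leaves an acyclic graph. -/
def IsFVS (S : Set V) : Prop := (G.induce Sᶜ).IsAcyclic

/-- A minimum feedback vertex set. -/
def IsMinFVS (S : Set V) : Prop :=
  IsFVS G S ∧ ∀ S', IsFVS G S' → S.ncard ≤ S'.ncard

/-- The feedback vertex set number. -/
noncomputable def fvsNum : ℕ := sInf {n | ∃ S, IsFVS G S ∧ S.ncard = n}

/-- An odd cycle transversal: its removal leaves a bipartite graph. -/
def IsOCT (S : Set V) : Prop := (G.induce Sᶜ).Colorable 2

/-- A minimum odd cycle transversal. -/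
def IsMinOCT (S : Set V) : Prop :=
  IsOCT G S ∧ ∀ S', IsOCT G S' → S.ncard ≤ S'.ncard

/-- The odd cycle transversal number. -/
noncomputable def octNum : ℕ := sInf {n | ∃ S, IsOCT G S ∧ S.ncard = n}

/-- An independent set: pairwise non-adjacent vertices. -/
def IsIndepSet' (I : Set V) : Prop := I.Pairwise (fun u v => ¬ G.Adj u v)

/-- A partition of `G` into `k` (vertex-disjoint) paths covering all vertices. -/
def IsPathPartition (k : ℕ) (P : Fin k → (u : V) × (v : V) × G.Walk u v) : Prop :=
  (∀ i, (P i).2.2.IsPath) ∧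
  (∀ i j, i ≠ j → ∀ x, x ∈ (P i).2.2.support → x ∉ (P j).2.2.support) ∧
  (∀ x : V, ∃ i, x ∈ (P i).2.2.support)

/-- The minimum number of paths in a partition of `G` into paths. -/
noncomputable def pathPartitionNum : ℕ :=
  sInf {k | ∃ P : Fin k → (u : V) × (v : V) × G.Walk u v, IsPathPartition G k P}

/-- `G` has a Hamiltonian cycle. -/
def HasHamCycle : Prop := ∃ (v : V) (p : G.Walk v v), p.IsCycle ∧ ∀ u : V, u ∈ p.support

/-- The number of vertices of a longest induced path of `G`. -/
noncomputable def lipNum : ℕ :=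
  sSup {n | ∃ S : Set V, Nonempty (G.induce S ≃g pathGraph n)}

/-- `X` is an induced matching with `k` edges: `X` has `2k` vertices and the
subgraph induced by `X` is `1`-regular. -/
def IsInducedMatching (X : Set V) (k : ℕ) : Prop :=
  X.ncard = 2 * k ∧ ∀ v ∈ X, ∃! u, u ∈ X ∧ G.Adj v u

/-- The maximum number of edges of an induced matching of `G`. -/
noncomputable def imNum : ℕ := sSup {k | ∃ X, IsInducedMatching G X k}

/-- An independent triangle packing with `k` triangles: pairwise disjoint
triangles with no edges of `G` between different triangles. -/
def IsIndepTrianglePacking (k : ℕ) (f : Fin k → Set V) : Prop :=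
  (∀ i, ∃ a b c : V, f i = {a, b, c} ∧ G.Adj a b ∧ G.Adj a c ∧ G.Adj b c) ∧
  (∀ i j, i ≠ j → ∀ u ∈ f i, ∀ v ∈ f j, u ≠ v ∧ ¬ G.Adj u v)

/-- The maximum number of triangles in an independent triangle packing of `G`. -/
noncomputable def itpNum : ℕ :=
  sSup {k | ∃ f : Fin k → Set V, IsIndepTrianglePacking G k f}

/-- `C` is the vertex set of an induced cycle of `G`. -/
def IsCycleSet (C : Set V) : Prop :=
  3 ≤ C.ncard ∧ (G.induce C).Connected ∧ ∀ v ∈ C, {u | u ∈ C ∧ G.Adj v u}.ncard = 2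

/-- An independent cycle packing with `k` cycles: pairwise disjoint induced
cycles with no edges of `G` between different cycles. -/
def IsIndepCyclePacking (k : ℕ) (f : Fin k → Set V) : Prop :=
  (∀ i, IsCycleSet G (f i)) ∧
  (∀ i j, i ≠ j → ∀ u ∈ f i, ∀ v ∈ f j, u ≠ v ∧ ¬ G.Adj u v)

/-- The maximum number of cycles in an independent cycle packing of `G`. -/
noncomputable def icpNum : ℕ :=
  sSup {k | ∃ f : Fin k → Set V, IsIndepCyclePacking G k f}

end Invariants

section InducedMatching

variable {V : Type*} (G : SimpleGraph V)

/-- The subgraph induced by `X` is `1`-regular. -/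
def IsInducedOneRegular (X : Set V) : Prop :=
  ∀ v ∈ X, ∃! u, u ∈ X ∧ G.Adj v u

variable {G}

theorem IsInducedOneRegular.even_ncard [Finite V] {X : Set V}
    (hX : IsInducedOneRegular G X) : Even X.ncard := by
  classical
  have := Fintype.ofFinite V
  have h := (G.induce X).even_card_odd_degree_vertices
  have hdeg : ∀ v : X, (G.induce X).degree v = 1 := by
    intro v
    rw [SimpleGraph.degree_eq_one_iff_existsUnique_adj]
    obtain ⟨u, ⟨hu, hvu⟩, huniq⟩ := hX v v.2
    exact ⟨⟨u, hu⟩, hvu, fun w hw => Subtype.ext (huniq w ⟨w.2, hw⟩)⟩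
  simpa [hdeg, Set.ncard_eq_toFinset_card'] using h

theorem bddAbove_inducedMatching [Finite V] :
    BddAbove {k | ∃ X, IsInducedMatching G X k} := by
  refine ⟨Nat.card V, ?_⟩
  rintro k ⟨X, hX, -⟩
  have := Set.ncard_le_card X
  omega

variable (G) in
theorem exists_isInducedMatching_imNum [Finite V] :
    ∃ X, IsInducedMatching G X (imNum G) :=
  Nat.sSup_mem (s := {k | ∃ X, IsInducedMatching G X k})
    ⟨0, ∅, by simp [IsInducedMatching]⟩ bddAbove_inducedMatching

theorem IsInducedOneRegular.ncard_le [Finite V] {X : Set V}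
    (hX : IsInducedOneRegular G X) : X.ncard ≤ 2 * imNum G := by
  obtain ⟨k, hk⟩ := hX.even_ncard
  have : k ≤ imNum G := le_csSup bddAbove_inducedMatching ⟨X, by omega, hX⟩
  omega

end InducedMatching

section Replacement

variable {V W : Type*} {G : SimpleGraph V} {H : SimpleGraph W} {M : Set V}

@[simp]
theorem modularReplacement_adj_inl_inl (u v : {v : V // v ∉ M}) :
    (modularReplacement G M H).Adj (Sum.inl u) (Sum.inl v) ↔ G.Adj u v := by
  simp only [modularReplacement, SimpleGraph.fromRel_adj, G.adj_comm v.1 u.1, or_self, ne_eq,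
    Sum.inl.injEq, and_iff_right_iff_imp]
  rintro h rfl
  exact G.irrefl h

@[simp]
theorem modularReplacement_adj_inr_inr (u v : W) :
    (modularReplacement G M H).Adj (Sum.inr u) (Sum.inr v) ↔ H.Adj u v := by
  simp only [modularReplacement, SimpleGraph.fromRel_adj, H.adj_comm v u, or_self, ne_eq,
    Sum.inr.injEq, and_iff_right_iff_imp]
  rintro h rfl
  exact H.irrefl h

@[simp]
theorem modularReplacement_adj_inl_inr (u : {v : V // v ∉ M}) (w : W) :
    (modularReplacement G M H).Adj (Sum.inl u) (Sum.inr w) ↔ ∃ m ∈ M, G.Adj u m := by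
  simp [modularReplacement]

@[simp]
theorem modularReplacement_adj_inr_inl (w : W) (u : {v : V // v ∉ M}) :
    (modularReplacement G M H).Adj (Sum.inr w) (Sum.inl u) ↔ ∃ m ∈ M, G.Adj u m := by
  simp [modularReplacement]

/-- The vertex set of the modular replacement that agrees with `X` outside the module and
with `Y` on the replacing graph. -/
def replacementSet (M X : Set V) (Y : Set W) : Set ({v : V // v ∉ M} ⊕ W) :=
  Sum.inl '' (Subtype.val ⁻¹' X) ∪ Sum.inr '' Y

@[simp]
theorem inl_mem_replacementSet {X : Set V} {Y : Set W} {u : {v : V // v ∉ M}} :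
    Sum.inl u ∈ replacementSet M X Y ↔ u.1 ∈ X := by
  simp [replacementSet]

@[simp]
theorem inr_mem_replacementSet {X : Set V} {Y : Set W} {w : W} :
    Sum.inr w ∈ replacementSet M X Y ↔ w ∈ Y := by
  simp [replacementSet]

theorem ncard_replacementSet [Finite V] [Finite W] (X : Set V) (Y : Set W) :
    (replacementSet M X Y).ncard = (X \ M).ncard + Y.ncard := by
  have hdisj : Disjoint (Sum.inl '' (Subtype.val ⁻¹' X : Set {v : V // v ∉ M}))
      (Sum.inr '' Y) := by
    rw [Set.disjoint_left]
    rintro _ ⟨a, -, rfl⟩ ⟨b, -, h⟩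
    cases h
  rw [replacementSet, Set.ncard_union_eq hdisj, Set.ncard_image_of_injective _ Sum.inl_injective,
    Set.ncard_image_of_injective _ Sum.inr_injective,
    ← Set.ncard_image_of_injective _ Subtype.val_injective]
  congr 2
  ext v
  simp [and_comm]

/-- If some edge of the induced matching `X` leaves the module, the matched vertex inside the
module can be exchanged for any vertex of the replacing graph. -/
theorem IsInducedOneRegular.replacementSet_singleton {X : Set V}
    (hX : IsInducedOneRegular G X) (hMod : G.IsModuleSet M) {x y : V}
    (hx : x ∈ X) (hxM : x ∈ M) (hy : y ∈ X) (hyM : y ∉ M) (hyx : G.Adj y x) (w : W) :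
    X ∩ M = {x} ∧
      IsInducedOneRegular (modularReplacement G M H) (replacementSet M X {w}) := by
  have hall : ∀ v ∉ M, ∀ m ∈ M, G.Adj v m → ∀ m' ∈ M, G.Adj v m' := by
    intro v hv m hm h
    exact (hMod v hv).resolve_right fun h' => h' m hm h
  have hM : ∀ z ∈ X, z ∈ M → z = x := fun z hz hzM =>
    (hX y hy).unique ⟨hz, hall y hyM x hxM hyx z hzM⟩ ⟨hx, hyx⟩
  refine ⟨Set.eq_singleton_iff_unique_mem.2 ⟨⟨hx, hxM⟩, fun z hz => hM z hz.1 hz.2⟩, ?_⟩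
  rintro (v | v) hv
  · simp only [inl_mem_replacementSet] at hv
    obtain ⟨u, ⟨hu, hvu⟩, huniq⟩ := hX v hv
    by_cases huM : u ∈ M
    · refine ⟨Sum.inr w, ⟨by simp, by simpa using ⟨u, huM, hvu⟩⟩, ?_⟩
      rintro (z | z) ⟨hz, hvz⟩
      · simp only [inl_mem_replacementSet, modularReplacement_adj_inl_inl] at hz hvz
        exact absurd (huniq z ⟨hz, hvz⟩ ▸ huM) z.2
      · simpa using hz
    · refine ⟨Sum.inl ⟨u, huM⟩, ⟨by simpa using hu, by simpa using hvu⟩, ?_⟩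
      rintro (z | z) ⟨hz, hvz⟩
      · simp only [inl_mem_replacementSet, modularReplacement_adj_inl_inl] at hz hvz
        exact congrArg _ (Subtype.ext (huniq z ⟨hz, hvz⟩))
      · simp only [modularReplacement_adj_inl_inr] at hvz
        obtain ⟨m, hm, hvm⟩ := hvz
        exact absurd (huniq x ⟨hx, hall v v.2 m hm hvm x hxM⟩ ▸ hxM) huM
  · refine ⟨Sum.inl ⟨y, hyM⟩, ⟨by simpa using hy, by simpa using ⟨x, hxM, hyx⟩⟩, ?_⟩
    rintro (z | z) ⟨hz, hvz⟩
    · simp only [inl_mem_replacementSet, modularReplacement_adj_inr_inl] at hz hvz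
      obtain ⟨m, hm, hzm⟩ := hvz
      exact congrArg _ (Subtype.ext ((hX x hx).unique
        ⟨hz, (hall z z.2 m hm hzm x hxM).symm⟩ ⟨hy, hyx.symm⟩))
    · simp only [inr_mem_replacementSet, Set.mem_singleton_iff,
        modularReplacement_adj_inr_inr] at hv hz hvz
      exact absurd (hz.trans hv.symm) hvz.ne'

/-- If no edge of the induced matching `X` leaves the module, and `Y` is an induced matching of
the replacing graph that is empty unless `X` is anticomplete to the module, then `X` outside the
module together with `Y` is an induced matching of the modular replacement. -/
theorem IsInducedOneRegular.replacementSet {X : Set V} {Y : Set W}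
    (hX : IsInducedOneRegular G X) (hY : IsInducedOneRegular H Y)
    (hcross : ∀ x ∈ X ∩ M, ∀ y ∈ X \ M, ¬ G.Adj y x)
    (hXY : ∀ y ∈ X \ M, Y.Nonempty → ∀ m ∈ M, ¬ G.Adj y m) :
    IsInducedOneRegular (modularReplacement G M H) (replacementSet M X Y) := by
  rintro (v | v) hv
  · simp only [inl_mem_replacementSet] at hv
    obtain ⟨u, ⟨hu, hvu⟩, huniq⟩ := hX v hv
    have huM : u ∉ M := fun h => hcross u ⟨hu, h⟩ v ⟨hv, v.2⟩ hvu
    refine ⟨Sum.inl ⟨u, huM⟩, ⟨by simpa using hu, by simpa using hvu⟩, ?_⟩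
    rintro (z | z) ⟨hz, hvz⟩
    · simp only [inl_mem_replacementSet, modularReplacement_adj_inl_inl] at hz hvz
      exact congrArg _ (Subtype.ext (huniq z ⟨hz, hvz⟩))
    · simp only [inr_mem_replacementSet, modularReplacement_adj_inl_inr] at hz hvz
      obtain ⟨m, hm, hvm⟩ := hvz
      exact absurd hvm (hXY v ⟨hv, v.2⟩ ⟨z, hz⟩ m hm)
  · simp only [inr_mem_replacementSet] at hv
    obtain ⟨u, ⟨hu, hvu⟩, huniq⟩ := hY v hv
    refine ⟨Sum.inr u, ⟨by simpa using hu, by simpa using hvu⟩, ?_⟩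
    rintro (z | z) ⟨hz, hvz⟩
    · simp only [inl_mem_replacementSet, modularReplacement_adj_inr_inl] at hz hvz
      obtain ⟨m, hm, hzm⟩ := hvz
      exact absurd hzm (hXY z ⟨hz, z.2⟩ ⟨v, hv⟩ m hm)
    · simp only [inr_mem_replacementSet, modularReplacement_adj_inr_inr] at hz hvz
      exact congrArg _ (huniq z ⟨hz, hvz⟩)

theorem IsInducedOneRegular.ncard_inter_le [Finite V] {X : Set V}
    (hX : IsInducedOneRegular G X)
    (hcross : ∀ x ∈ X ∩ M, ∀ y ∈ X \ M, ¬ G.Adj y x) :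
    (X ∩ M).ncard ≤ 2 * imNum (G.induce M) := by
  have hreg : IsInducedOneRegular (G.induce M) (Subtype.val ⁻¹' X) := by
    intro v hv
    obtain ⟨u, ⟨hu, hvu⟩, huniq⟩ := hX v hv
    have huM : u ∈ M := by
      by_contra h
      exact hcross v ⟨hv, v.2⟩ u ⟨hu, h⟩ hvu.symm
    exact ⟨⟨u, huM⟩, ⟨hu, hvu⟩, fun z hz => Subtype.ext (huniq z ⟨hz.1, hz.2⟩)⟩
  have himage : Subtype.val '' (Subtype.val ⁻¹' X : Set M) = X ∩ M := by
    ext v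
    simp [and_comm]
  rw [← himage, Set.ncard_image_of_injective _ Subtype.val_injective]
  exact hreg.ncard_le

/-- An induced matching of `G` gives one of the modular replacement that is at least as large. -/
theorem IsInducedOneRegular.exists_replacementSet [Finite V] [Finite W] [Nonempty W]
    {X : Set V} (hX : IsInducedOneRegular G X) (hMod : G.IsModuleSet M)
    (him : imNum (G.induce M) ≤ imNum H) :
    ∃ Y : Set W, (X ∩ M).ncard ≤ Y.ncard ∧
      IsInducedOneRegular (modularReplacement G M H) (_root_.replacementSet M X Y) := by
  by_cases hcross : ∀ x ∈ X ∩ M, ∀ y ∈ X \ M, ¬ G.Adj y x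
  · obtain hempty | ⟨x, hx⟩ := (X ∩ M).eq_empty_or_nonempty
    · refine ⟨∅, by simp [hempty], hX.replacementSet ?_ hcross (by simp)⟩
      intro v hv
      exact hv.elim
    · obtain ⟨Y, hYcard, hY⟩ := exists_isInducedMatching_imNum H
      refine ⟨Y, ?_, hX.replacementSet hY hcross fun y hy _ => ?_⟩
      · have := hX.ncard_inter_le hcross
        omega
      · exact (hMod y hy.2).resolve_left fun h => hcross x hx y hy (h x hx.2)
  · push Not at hcross
    obtain ⟨x, hx, y, hy, hyx⟩ := hcross
    obtain ⟨w⟩ := ‹Nonempty W›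
    obtain ⟨hXM, hreg⟩ :=
      hX.replacementSet_singleton (H := H) hMod hx.1 hx.2 hy.1 hy.2 hyx w
    exact ⟨{w}, by simp [hXM], hreg⟩

end Replacement

theorem stmt17 {V W : Type*} [Fintype V] [Fintype W]
    (G : SimpleGraph V) (H : SimpleGraph W) (M : Set V)
    (hG : G.Connected) (hH : H.Connected)
    (hMod : G.IsModuleSet M) (hne : M.Nonempty) (hproper : M ≠ Set.univ)
    (him : imNum (G.induce M) = imNum H) :
    imNum G ≤ imNum (modularReplacement G M H) := by
  have := hH.nonempty
  obtain ⟨X, hXcard, hX⟩ := exists_isInducedMatching_imNum G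
  obtain ⟨Y, hle, hY⟩ := IsInducedOneRegular.exists_replacementSet hX hMod him.le
  have hbound := hY.ncard_le
  have hcard := Set.ncard_inter_add_ncard_sdiff_eq_ncard X M
  rw [ncard_replacementSet] at hbound
  omega
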